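/- Let L be a field, let m, n ≥ 1, and let a₀, …, a_m, b₀, …, b_n ∈ L; set P = Σ_{i=0}^m a_i Xⁱ and Q = Σ_{i=0}^n b_i Xⁱ. Let Syl denote the (m+n)×(m+n) matrix whose row r, for 1 ≤ r ≤ n, has entry a_{m−c} in column r+c for 0 ≤ c ≤ m and zeros elsewhere, and whose row n+r, for 1 ≤ r ≤ m, has entry b_{n−c} in column r+c for 0 ≤ c ≤ n and zeros elsewhere. For 0 ≤ j < min(m,n), let S_j(P,Q) be the (m+n−2j)×(m+n−2j) matrix obtained from Syl by deleting rows n−j+1,…,n, rows m+n−j+1,…,m+n, and the last 2j columns. Let k ≤ min(m,n). If P and Q have a common polynomial divisor of degree at least k (equivalently, at least k common roots in an algebraic closure of L, counted with multiplicity), then det S_j(P,Q) = 0 for all 0 ≤ j ≤ k−1. Conversely, if det S_j(P,Q) = 0 for all 0 ≤ j ≤ k−1, then either P and Q have a common polynomial divisor of degree at least k, or a_m = 0 and b_n = 0. -/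

import Mathlib

namespace Stmt4

/-- The matrix `S_j(P,Q)` obtained from the Sylvester matrix of `P` (formal degree `m`,
coefficients `a`) and `Q` (formal degree `n`, coefficients `b`) by deleting the last `j`
rows of `a`-coefficients, the last `j` rows of `b`-coefficients, and the last `2j`
columns.  For `j = 0` it is the Sylvester matrix itself. -/
def sylvesterMinor {R : Type*} [CommRing R] (m n j : ℕ) (a b : ℕ → R) :
    Matrix (Fin (m + n - 2 * j)) (Fin (m + n - 2 * j)) R :=
  fun i c =>
    if (i : ℕ) < n - j then
      (if (i : ℕ) ≤ (c : ℕ) ∧ (c : ℕ) ≤ (i : ℕ) + m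
        then a (m - ((c : ℕ) - (i : ℕ))) else 0)
    else
      (if (i : ℕ) - (n - j) ≤ (c : ℕ) ∧ (c : ℕ) ≤ ((i : ℕ) - (n - j)) + n
        then b (n - ((c : ℕ) - ((i : ℕ) - (n - j)))) else 0)

open Polynomial

lemma coeff_sum_range_C_mul_X_pow {R : Type*} [Semiring R] (m : ℕ) (a : ℕ → R) (i : ℕ) :
    (∑ i ∈ Finset.range m, C (a i) * X ^ i).coeff i = if i < m then a i else 0 := by
  simp [coeff_C_mul, coeff_X_pow]

lemma coeff_mul_eq_sum_range_reflect {R : Type*} [CommRing R] {p : ℕ} {U : R[X]}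
    (hU : U.degree < p) (P : R[X]) (e : ℕ) :
    (U * P).coeff e =
      ∑ i ∈ Finset.range p, U.coeff (p - 1 - i) * (X ^ (p - 1 - i) * P).coeff e := by
  refine Eq.trans ?_ (Finset.sum_range_reflect (fun i => U.coeff i * (X ^ i * P).coeff e) p).symm
  have hsum : U = ∑ i ∈ Finset.range p, C (U.coeff i) * X ^ i := by
    ext i
    rw [coeff_sum_range_C_mul_X_pow]
    split_ifs with h
    · rfl
    · exact coeff_eq_zero_of_degree_lt (hU.trans_le (by exact_mod_cast not_lt.mp h))
  conv_lhs => rw [hsum]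
  rw [Finset.sum_mul, finsetSum_coeff]
  exact Finset.sum_congr rfl fun i _ => by rw [mul_assoc, coeff_C_mul]

/-- The coefficients of `U` and `V`, in decreasing order of exponents, as a row vector indexed by
the rows of the matrix `S_j`. -/
def coeffRow {R : Type*} [CommRing R] (m n j : ℕ) (U V : R[X]) :
    Fin (m + n - 2 * j) → R :=
  fun i => if (i : ℕ) < n - j then U.coeff (n - j - 1 - i)
    else V.coeff (m - j - 1 - ((i : ℕ) - (n - j)))

section

variable {R : Type*} [CommRing R] {m n j : ℕ} {a b : ℕ → R} {P Q : R[X]}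

lemma vecMul_coeffRow_sylvesterMinor (hjm : j < m) (hjn : j < n)
    (hP : P = ∑ i ∈ Finset.range (m + 1), C (a i) * X ^ i)
    (hQ : Q = ∑ i ∈ Finset.range (n + 1), C (b i) * X ^ i)
    {U V : R[X]} (hU : U.degree < (n - j : ℕ)) (hV : V.degree < (m - j : ℕ))
    (c : Fin (m + n - 2 * j)) :
    Matrix.vecMul (coeffRow m n j U V) (sylvesterMinor m n j a b) c =
      (U * P + V * Q).coeff (m + n - j - 1 - c) := by
  obtain ⟨c, hc⟩ := c
  rw [coeff_add, coeff_mul_eq_sum_range_reflect hU, coeff_mul_eq_sum_range_reflect hV,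
    Matrix.vecMul, dotProduct]
  unfold coeffRow sylvesterMinor
  refine (Finset.sum_range (fun i : ℕ => (if i < n - j then U.coeff (n - j - 1 - i)
      else V.coeff (m - j - 1 - (i - (n - j)))) *
    (if i < n - j then
      (if i ≤ c ∧ c ≤ i + m then a (m - (c - i)) else 0)
    else
      (if i - (n - j) ≤ c ∧ c ≤ (i - (n - j)) + n
        then b (n - (c - (i - (n - j)))) else 0)))).symm.trans ?_
  dsimp only
  rw [show m + n - 2 * j = (n - j) + (m - j) by omega, Finset.sum_range_add]
  congr 1
  · refine Finset.sum_congr rfl fun i hi => ?_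
    rw [Finset.mem_range] at hi
    rw [if_pos hi, if_pos hi, coeff_X_pow_mul', hP, coeff_sum_range_C_mul_X_pow]
    congr 1
    split_ifs <;> first | rfl | omega | (congr 1; omega)
  · refine Finset.sum_congr rfl fun i hi => ?_
    rw [Finset.mem_range] at hi
    rw [if_neg (by omega), if_neg (by omega), Nat.add_sub_cancel_left, coeff_X_pow_mul', hQ,
      coeff_sum_range_C_mul_X_pow]
    congr 1
    split_ifs <;> first | rfl | omega | (congr 1; omega)

lemma coeffRow_ne_zero_iff (hjm : j < m) (hjn : j < n)
    {U V : R[X]} (hU : U.degree < (n - j : ℕ)) (hV : V.degree < (m - j : ℕ)) :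
    coeffRow m n j U V ≠ 0 ↔ U ≠ 0 ∨ V ≠ 0 := by
  rw [← not_and_or, not_iff_not]
  constructor
  · intro h
    constructor
    · ext i
      by_cases hi : i < n - j
      · have := congrFun h ⟨n - j - 1 - i, by omega⟩
        simpa [coeffRow, show n - j - 1 - i < n - j by omega,
          show n - j - 1 - (n - j - 1 - i) = i by omega] using this
      · exact coeff_eq_zero_of_degree_lt (hU.trans_le (by exact_mod_cast not_lt.mp hi))
    · ext i
      by_cases hi : i < m - j
      · have := congrFun h ⟨n - j + (m - j - 1 - i), by omega⟩
        simpa [coeffRow, show m - j - 1 - (m - j - 1 - i) = i by omega] using this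
      · exact coeff_eq_zero_of_degree_lt (hV.trans_le (by exact_mod_cast not_lt.mp hi))
  · rintro ⟨rfl, rfl⟩
    ext i
    simp [coeffRow]

lemma exists_coeffRow_eq (v : Fin (m + n - 2 * j) → R) (hjm : j < m) (hjn : j < n) :
    ∃ U V : R[X], U.degree < (n - j : ℕ) ∧ V.degree < (m - j : ℕ) ∧ coeffRow m n j U V = v := by
  let w : ℕ → R := fun i => if h : i < m + n - 2 * j then v ⟨i, h⟩ else 0
  refine ⟨∑ i ∈ Finset.range (n - j), C (w (n - j - 1 - i)) * X ^ i,
    ∑ i ∈ Finset.range (m - j), C (w (n - j + (m - j - 1 - i))) * X ^ i, ?_, ?_, ?_⟩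
  · rw [degree_lt_iff_coeff_zero]
    intro i hi
    rw [coeff_sum_range_C_mul_X_pow, if_neg (by omega)]
  · rw [degree_lt_iff_coeff_zero]
    intro i hi
    rw [coeff_sum_range_C_mul_X_pow _ (fun i => w (n - j + (m - j - 1 - i))),
      if_neg (by omega)]
  · ext ⟨i, hi⟩
    have hw : w i = v ⟨i, hi⟩ := dif_pos hi
    rw [← hw]
    simp only [coeffRow, coeff_sum_range_C_mul_X_pow (n - j) (fun i => w (n - j - 1 - i)),
      coeff_sum_range_C_mul_X_pow (m - j) (fun i => w (n - j + (m - j - 1 - i)))]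
    split_ifs <;> first | omega | (congr 1; omega)

lemma natDegree_sum_range_C_mul_X_pow_le (m : ℕ) (a : ℕ → R) :
    (∑ i ∈ Finset.range (m + 1), C (a i) * X ^ i).natDegree ≤ m := by
  rw [natDegree_le_iff_coeff_eq_zero]
  intro i hi
  rw [coeff_sum_range_C_mul_X_pow, if_neg (by omega)]

lemma det_sylvesterMinor_eq_zero_iff [IsDomain R] (hjm : j < m) (hjn : j < n)
    (hP : P = ∑ i ∈ Finset.range (m + 1), C (a i) * X ^ i)
    (hQ : Q = ∑ i ∈ Finset.range (n + 1), C (b i) * X ^ i) :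
    (sylvesterMinor m n j a b).det = 0 ↔
      ∃ U V : R[X], (U ≠ 0 ∨ V ≠ 0) ∧ U.degree < (n - j : ℕ) ∧ V.degree < (m - j : ℕ) ∧
        (U * P + V * Q).degree < j := by
  rw [← Matrix.exists_vecMul_eq_zero_iff]
  constructor
  · rintro ⟨v, hv, hv0⟩
    obtain ⟨U, V, hU, hV, rfl⟩ := exists_coeffRow_eq v hjm hjn
    refine ⟨U, V, (coeffRow_ne_zero_iff hjm hjn hU hV).1 hv, hU, hV, ?_⟩
    rw [degree_lt_iff_coeff_zero]
    intro e he
    by_cases hlt : e < m + n - j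
    · have := vecMul_coeffRow_sylvesterMinor hjm hjn hP hQ hU hV ⟨m + n - j - 1 - e, by omega⟩
      rw [hv0, Fin.val_mk, show m + n - j - 1 - (m + n - j - 1 - e) = e by omega] at this
      exact this.symm
    · have hUP : (U * P).degree < e := by
        by_cases hU0 : U = 0
        · simp [hU0]
        have hPm : P.natDegree ≤ m := hP ▸ natDegree_sum_range_C_mul_X_pow_le m a
        have hUn := (natDegree_lt_iff_degree_lt hU0).2 hU
        refine degree_le_natDegree.trans_lt (Nat.cast_lt.2 ?_)
        have := natDegree_mul_le (p := U) (q := P)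
        omega
      have hVQ : (V * Q).degree < e := by
        by_cases hV0 : V = 0
        · simp [hV0]
        have hQn : Q.natDegree ≤ n := hQ ▸ natDegree_sum_range_C_mul_X_pow_le n b
        have hVm := (natDegree_lt_iff_degree_lt hV0).2 hV
        refine degree_le_natDegree.trans_lt (Nat.cast_lt.2 ?_)
        have := natDegree_mul_le (p := V) (q := Q)
        omega
      rw [coeff_add, coeff_eq_zero_of_degree_lt hUP, coeff_eq_zero_of_degree_lt hVQ, add_zero]
  · rintro ⟨U, V, h0, hU, hV, hdeg⟩
    refine ⟨coeffRow m n j U V, (coeffRow_ne_zero_iff hjm hjn hU hV).2 h0, ?_⟩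
    ext c
    rw [vecMul_coeffRow_sylvesterMinor hjm hjn hP hQ hU hV c]
    have := c.2
    exact (degree_lt_iff_coeff_zero _ _).1 hdeg _ (by omega)

end

/-- If `P` has exact degree `m`, a combination `U * P + V * Q` of degree less than that of
`gcd P Q`, with `V` of degree less than `m - deg (gcd P Q)`, is the trivial one. -/
lemma eq_zero_of_degree_combination_lt {L : Type*} [Field L] [DecidableEq L] {m : ℕ}
    {P Q U V : L[X]}
    (hP0 : P ≠ 0) (hP : P.natDegree = m)
    (hV : V.degree < (m - (EuclideanDomain.gcd P Q).natDegree : ℕ))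
    (h : (U * P + V * Q).degree < (EuclideanDomain.gcd P Q).natDegree) :
    U = 0 ∧ V = 0 := by
  set G := EuclideanDomain.gcd P Q with hG
  have hG0 : G ≠ 0 := fun h0 => hP0 (EuclideanDomain.gcd_eq_zero_iff.1 h0).1
  obtain ⟨P', hP'⟩ : G ∣ P := EuclideanDomain.gcd_dvd_left P Q
  obtain ⟨Q', hQ'⟩ : G ∣ Q := EuclideanDomain.gcd_dvd_right P Q
  have hcomb : U * P + V * Q = 0 := by
    refine eq_zero_of_dvd_of_degree_lt (p := G) ?_ (by rwa [degree_eq_natDegree hG0])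
    exact dvd_add ((EuclideanDomain.gcd_dvd_left P Q).mul_left U)
      ((EuclideanDomain.gcd_dvd_right P Q).mul_left V)
  have hcop : IsCoprime P' Q' := by
    refine ⟨EuclideanDomain.gcdA P Q, EuclideanDomain.gcdB P Q, mul_left_cancel₀ hG0 ?_⟩
    have := EuclideanDomain.gcd_eq_gcd_ab P Q
    rw [← hG] at this
    linear_combination (-1 : L[X]) * this - EuclideanDomain.gcdA P Q * hP'
      - EuclideanDomain.gcdB P Q * hQ'
  have hP'0 : P' ≠ 0 := by
    rintro rfl
    exact hP0 (by rw [hP', mul_zero])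
  have hdegP' : P'.natDegree = m - G.natDegree := by
    have := natDegree_mul hG0 hP'0
    rw [← hP', hP] at this
    omega
  have hcomb' : U * P' + V * Q' = 0 := by
    refine mul_left_cancel₀ hG0 ?_
    linear_combination hcomb - U * hP' - V * hQ'
  have hV0 : V = 0 := by
    refine eq_zero_of_dvd_of_degree_lt (p := P') ?_
      (by rwa [degree_eq_natDegree hP'0, hdegP'])
    exact hcop.dvd_of_dvd_mul_right ⟨-U, by linear_combination hcomb'⟩
  refine ⟨?_, hV0⟩
  rw [hV0, zero_mul, add_zero] at hcomb
  exact (mul_eq_zero.1 hcomb).resolve_right hP0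

/-- The generalized-resultant criterion for two polynomials to have `k` common roots:
with `P = Σ_{i≤m} a_i Xⁱ` and `Q = Σ_{i≤n} b_i Xⁱ` over a field `L` and `k ≤ min m n`,
if `P` and `Q` have a common divisor of degree at least `k` then `det S_j(P,Q) = 0` for
`0 ≤ j ≤ k−1`; conversely if these determinants vanish then either `P` and `Q` have a
common divisor of degree at least `k`, or `a_m = 0` and `b_n = 0`. -/
theorem common_roots_criterion
    (L : Type*) [Field L] (m n k : ℕ) (hm : 1 ≤ m) (hn : 1 ≤ n)
    (hk : k ≤ min m n) (a b : ℕ → L)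
    (P Q : Polynomial L)
    (hP : P = ∑ i ∈ Finset.range (m + 1), Polynomial.C (a i) * Polynomial.X ^ i)
    (hQ : Q = ∑ i ∈ Finset.range (n + 1), Polynomial.C (b i) * Polynomial.X ^ i) :
    ((∃ D : Polynomial L, k ≤ D.natDegree ∧ D ∣ P ∧ D ∣ Q) →
      ∀ j < k, (sylvesterMinor m n j a b).det = 0)
    ∧ ((∀ j < k, (sylvesterMinor m n j a b).det = 0) →
      (∃ D : Polynomial L, k ≤ D.natDegree ∧ D ∣ P ∧ D ∣ Q) ∨ (a m = 0 ∧ b n = 0)) := by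
  classical
  have hPm : P.natDegree ≤ m := hP ▸ natDegree_sum_range_C_mul_X_pow_le m a
  have hQn : Q.natDegree ≤ n := hQ ▸ natDegree_sum_range_C_mul_X_pow_le n b
  constructor
  · rintro ⟨D, hD, ⟨P', hP'⟩, ⟨Q', hQ'⟩⟩ j hj
    rw [det_sylvesterMinor_eq_zero_iff (by omega) (by omega) hP hQ]
    have hD0 : D ≠ 0 := by
      rintro rfl
      simp at hD
      omega
    by_cases h0 : P' = 0 ∧ Q' = 0
    · refine ⟨1, 0, Or.inl one_ne_zero, ?_, ?_, ?_⟩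
      · rw [degree_one]
        exact_mod_cast (by omega : 0 < n - j)
      · simp
      · simp [hP', h0.1]
    · refine ⟨Q', -P', ?_, ?_, ?_, ?_⟩
      · rw [neg_ne_zero]
        tauto
      · by_cases hz : Q' = 0
        · simp [hz]
        rw [← natDegree_lt_iff_degree_lt hz]
        rw [hQ', natDegree_mul hD0 hz] at hQn
        omega
      · by_cases hz : P' = 0
        · simp [hz]
        rw [degree_neg, ← natDegree_lt_iff_degree_lt hz]
        rw [hP', natDegree_mul hD0 hz] at hPm
        omega
      · rw [show Q' * P + -P' * Q = 0 by rw [hP', hQ']; ring, degree_zero]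
        exact WithBot.bot_lt_coe _
  · intro hdet
    by_contra! hcon
    obtain ⟨hD, hab⟩ := hcon
    have hlt (D : L[X]) (hDP : D ∣ P) (hDQ : D ∣ Q) : D.natDegree < k := by
      by_contra! hle
      exact hD D hle hDP hDQ
    have hcomb (D : L[X]) (hDP : D ∣ P) (hDQ : D ∣ Q) :=
      (det_sylvesterMinor_eq_zero_iff (by have := hlt D hDP hDQ; omega)
        (by have := hlt D hDP hDQ; omega) hP hQ).1 (hdet _ (hlt D hDP hDQ))
    have ham : P.coeff m = a m := by simp [hP]
    have hbn : Q.coeff n = b n := by simp [hQ]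
    by_cases ha : a m = 0
    · have hQc : Q.coeff n ≠ 0 := hbn ▸ hab ha
      obtain ⟨U, V, hUV, hU, -, h⟩ := hcomb _ (EuclideanDomain.gcd_dvd_right Q P)
        (EuclideanDomain.gcd_dvd_left Q P)
      have := eq_zero_of_degree_combination_lt (fun h0 => hQc (by simp [h0]))
        (hQn.antisymm (le_natDegree_of_ne_zero hQc)) hU (add_comm (U * P) _ ▸ h)
      tauto
    · have hPc : P.coeff m ≠ 0 := ham ▸ ha
      obtain ⟨U, V, hUV, -, hV, h⟩ := hcomb _ (EuclideanDomain.gcd_dvd_left P Q)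
        (EuclideanDomain.gcd_dvd_right P Q)
      have := eq_zero_of_degree_combination_lt (fun h0 => hPc (by simp [h0]))
        (hPm.antisymm (le_natDegree_of_ne_zero hPc)) hV h
      tauto

end Stmt4
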